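/- arXiv:1210.1598 — 2 statements merged into one kernel-verified Lean document; each statement's English description precedes it below -/
import Mathlib

section
/- There exists a constant M > 0, depending only on n, m, Σ, R and J, such that for every λ ∈ ℝ^m with nonnegative entries the minimized objective satisfies |inf_{ω ∈ D} K(ω, λ)| ≤ M(1 + ‖λ‖²). -/
open MeasureTheory Set Matrix
open scoped ENNReal

/-- The (extended-real-valued) integral `∫ log(1 + a z) ν(dz)`, defined as the difference,
in `EReal`, of the lower integrals of the positive and negative parts.  It is a well-defined
element of `[−∞, +∞)` whenever the positive part is integrable. -/
noncomputable def Ilog (ν : Measure ℝ) (a : ℝ) : EReal :=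
  ((∫⁻ z, ENNReal.ofReal (Real.log (1 + a * z)) ∂ν : ℝ≥0∞) : EReal)
    - ((∫⁻ z, ENNReal.ofReal (-Real.log (1 + a * z)) ∂ν : ℝ≥0∞) : EReal)

/-- The log-investor objective
`K(ω, λ) = −ω'R + (1/2) ω'Σω − Σ_l λ_l ∫ log(1 + (ω'J)_l z) ν_l(dz)`,
with values in `(−∞, +∞]`. -/
noncomputable def Kobj {ι : Type*} [Fintype ι] {m : ℕ}
    (Sig : Matrix ι ι ℝ) (R : ι → ℝ) (J : Matrix ι (Fin m) ℝ)
    (ν : Fin m → Measure ℝ) (ω : ι → ℝ) (lam : Fin m → ℝ) : EReal :=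
  (((-(ω ⬝ᵥ R) + 2⁻¹ * (ω ⬝ᵥ Sig.mulVec ω)) : ℝ) : EReal)
    - ∑ l, ((lam l : ℝ) : EReal) * Ilog (ν l) (Matrix.vecMul ω J l)

/-- The domain `D = {ω : (ω'J)_l ≥ −1 for all l}`. -/
def Dset {ι : Type*} [Fintype ι] {m : ℕ} (J : Matrix ι (Fin m) ℝ) : Set (ι → ℝ) :=
  {ω | ∀ l, -1 ≤ Matrix.vecMul ω J l}

lemma Ilog_le_abs (ν : Measure ℝ) [IsProbabilityMeasure ν] (hν : ν (Set.Icc (0 : ℝ) 1)ᶜ = 0)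
    (a b : ℝ) (ha : -1 ≤ a) (hab : |a| ≤ b) : Ilog ν a ≤ (b : EReal) := by
  have hb : 0 ≤ b := (abs_nonneg a).trans hab
  have h1 : ∫⁻ z, ENNReal.ofReal (Real.log (1 + a * z)) ∂ν ≤ ENNReal.ofReal b := by
    calc ∫⁻ z, ENNReal.ofReal (Real.log (1 + a * z)) ∂ν ≤ ∫⁻ z, ENNReal.ofReal b ∂ν := by
          apply lintegral_mono_ae
          have hz : ∀ᵐ z ∂ν, z ∈ Set.Icc (0 : ℝ) 1 := by
            rw [ae_iff]; exact hν
          filter_upwards [hz] with z hz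
          apply ENNReal.ofReal_le_ofReal
          have h0 : 0 ≤ 1 + a * z := by nlinarith [hz.1, hz.2]
          rcases h0.eq_or_lt with h | h
          · rw [← h]; simpa using hb
          · have := Real.log_le_sub_one_of_pos h
            have h2 : a * z ≤ |a| := by
              have := le_abs_self a
              have := abs_nonneg a
              nlinarith [hz.1, hz.2]
            linarith
      _ = ENNReal.ofReal b := by simp
  unfold Ilog
  calc _ ≤ ((∫⁻ z, ENNReal.ofReal (Real.log (1 + a * z)) ∂ν : ℝ≥0∞) : EReal) - 0 :=
        EReal.sub_le_sub le_rfl (EReal.coe_ennreal_nonneg _)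
    _ ≤ ((ENNReal.ofReal b : ℝ≥0∞) : EReal) := by
        rw [sub_zero]; exact EReal.coe_ennreal_le_coe_ennreal_iff.2 h1
    _ = b := by rw [EReal.coe_ennreal_ofReal, max_eq_left hb]

lemma posDef_lower {n : ℕ} (hn : 1 ≤ n) (Sig : Matrix (Fin n) (Fin n) ℝ) (hSig : Sig.PosDef) :
    ∃ c : ℝ, 0 < c ∧ ∀ ω : Fin n → ℝ, c * ‖ω‖ ^ 2 ≤ ω ⬝ᵥ Sig.mulVec ω := by
  haveI : Nonempty (Fin n) := ⟨⟨0, hn⟩⟩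
  have hne : (Metric.sphere (0 : Fin n → ℝ) 1).Nonempty :=
    NormedSpace.sphere_nonempty.2 zero_le_one
  have hcont : Continuous (fun ω : Fin n → ℝ => ω ⬝ᵥ Sig.mulVec ω) := by fun_prop
  obtain ⟨u, hu, hmin⟩ := (isCompact_sphere (0 : Fin n → ℝ) 1).exists_isMinOn hne hcont.continuousOn
  have hu0 : u ≠ 0 := by
    rintro rfl
    simp at hu
  refine ⟨u ⬝ᵥ Sig.mulVec u, by simpa using hSig.dotProduct_mulVec_pos hu0, fun ω => ?_⟩
  by_cases hω : ω = 0
  · simp [hω]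
  have hpos : 0 < ‖ω‖ := norm_pos_iff.2 hω
  have hmem : ‖ω‖⁻¹ • ω ∈ Metric.sphere (0 : Fin n → ℝ) 1 := by
    simp [norm_smul, hpos.ne']
  have h := hmin hmem
  simp only [mem_setOf_eq, Matrix.mulVec_smul, dotProduct_smul, smul_dotProduct, smul_eq_mul] at h
  calc _ ≤ (‖ω‖⁻¹ * (‖ω‖⁻¹ * (ω ⬝ᵥ Sig.mulVec ω))) * ‖ω‖ ^ 2 := by gcongr
    _ = _ := by field_simp

lemma abs_dot_le {n : ℕ} (ω v : Fin n → ℝ) (b : ℝ) (hv : ∀ i, |v i| ≤ b) :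
    |ω ⬝ᵥ v| ≤ n * b * ‖ω‖ := by
  unfold dotProduct
  calc |∑ i, ω i * v i| ≤ ∑ i, |ω i * v i| := Finset.abs_sum_le_sum_abs _ _
    _ ≤ ∑ _i : Fin n, ‖ω‖ * b := by
        apply Finset.sum_le_sum
        intro i _
        rw [abs_mul]
        exact mul_le_mul (norm_le_pi_norm ω i) (hv i) (abs_nonneg _) (norm_nonneg _)
    _ = n * b * ‖ω‖ := by simp; ring

/-- There is a constant `M > 0`, depending only on `n, m, Σ, R, J`, such that for every
nonnegative `λ` the minimized objective satisfies `|inf_{ω ∈ D} K(ω, λ)| ≤ M(1 + ‖λ‖²)`. -/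
theorem logObjective_inf_quadratic_bound
    (n m : ℕ) (hn : 1 ≤ n) (hm : 1 ≤ m)
    (Sig : Matrix (Fin n) (Fin n) ℝ) (hSig : Sig.PosDef)
    (R : Fin n → ℝ) (J : Matrix (Fin n) (Fin m) ℝ)
    (hJ : ∀ i l, J i l ∈ Set.Icc (-1 : ℝ) 0) :
    ∃ M : ℝ, 0 < M ∧
      ∀ ν : Fin m → Measure ℝ, (∀ l, IsProbabilityMeasure (ν l)) →
        (∀ l, ν l (Set.Icc (0 : ℝ) 1)ᶜ = 0) →
        ∀ lam : Fin m → ℝ, (∀ l, 0 ≤ lam l) →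
          (((-(M * (1 + ‖lam‖ ^ 2))) : ℝ) : EReal) ≤ (⨅ ω ∈ Dset J, Kobj Sig R J ν ω lam)
          ∧ (⨅ ω ∈ Dset J, Kobj Sig R J ν ω lam) ≤ (((M * (1 + ‖lam‖ ^ 2)) : ℝ) : EReal) := by
  obtain ⟨c, hc, hq⟩ := posDef_lower hn Sig hSig
  set A : ℝ := n * ‖R‖ with hA
  set B : ℝ := n * m with hB
  have hM : 0 < (A ^ 2 + B ^ 2) / c + 1 := by positivity
  refine ⟨(A ^ 2 + B ^ 2) / c + 1, hM, ?_⟩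
  intro ν hν hν1 lam hlam
  constructor
  · refine le_iInf₂ fun ω hω => ?_
    have hsum : ∑ l, ((lam l : ℝ) : EReal) * Ilog (ν l) (Matrix.vecMul ω J l)
        ≤ ((B * ‖lam‖ * ‖ω‖ : ℝ) : EReal) := by
      calc _ ≤ ∑ _l : Fin m, ((‖lam‖ * (n * ‖ω‖) : ℝ) : EReal) := by
            apply Finset.sum_le_sum
            intro l _
            haveI := hν l
            have habs : |Matrix.vecMul ω J l| ≤ n * ‖ω‖ := by
              have := abs_dot_le ω (fun i => J i l) 1
                (fun i => abs_le.2 ⟨(hJ i l).1, (hJ i l).2.trans zero_le_one⟩)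
              simpa [Matrix.vecMul] using this
            have h1 := Ilog_le_abs (ν l) (hν1 l) _ _ (hω l) habs
            calc _ ≤ ((lam l : ℝ) : EReal) * ((n * ‖ω‖ : ℝ) : EReal) :=
                  mul_le_mul_of_nonneg_left h1 (EReal.coe_nonneg.2 (hlam l))
              _ ≤ _ := by
                  rw [← EReal.coe_mul, EReal.coe_le_coe_iff]
                  have : lam l ≤ ‖lam‖ := (le_abs_self _).trans (norm_le_pi_norm lam l)
                  gcongr
        _ = _ := by
            rw [Finset.sum_const, Finset.card_univ, Fintype.card_fin, ← EReal.coe_nsmul]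
            congr 1
            simp only [hB, nsmul_eq_mul]; ring
    have hR : |ω ⬝ᵥ R| ≤ A * ‖ω‖ := abs_dot_le ω R ‖R‖ (fun i => norm_le_pi_norm R i)
    have hR' := (le_abs_self _).trans hR
    unfold Kobj
    refine le_trans ?_ (EReal.sub_le_sub le_rfl hsum)
    rw [← EReal.coe_sub, EReal.coe_le_coe_iff]
    have hqω := hq ω
    set x := ‖ω‖
    set L := ‖lam‖
    have key : -((A ^ 2 + B ^ 2 * L ^ 2) / c) ≤ c / 2 * x ^ 2 - (A + B * L) * x := by
      rw [← sub_nonneg]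
      have : c / 2 * x ^ 2 - (A + B * L) * x - -((A ^ 2 + B ^ 2 * L ^ 2) / c)
          = ((c * x - (A + B * L)) ^ 2 + (A - B * L) ^ 2) / (2 * c) := by
        field_simp; ring
      rw [this]; positivity
    have h2 : (A ^ 2 + B ^ 2 * L ^ 2) / c ≤ ((A ^ 2 + B ^ 2) / c + 1) * (1 + L ^ 2) := by
      have : ((A ^ 2 + B ^ 2) / c + 1) * (1 + L ^ 2) - (A ^ 2 + B ^ 2 * L ^ 2) / c
          = (A ^ 2 * L ^ 2 + B ^ 2) / c + (1 + L ^ 2) := by field_simp; ring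
      rw [← sub_nonneg, this]; positivity
    linarith
  · refine (iInf₂_le (0 : Fin n → ℝ) (by intro l; simp)).trans ?_
    have h0 : Kobj Sig R J ν 0 lam = 0 := by simp [Kobj, Ilog]
    rw [h0]
    exact EReal.coe_nonneg.2 (by positivity)
end

section
/- For every ω ∈ ℝⁿ written as ω = Σ_{l=1}^m ω̄_l 1_l + ω⊥ with ω⊥ ∈ V⊥ and lying in the domain D, and every λ ∈ ℝ^m with nonnegative entries, the log-investor objective separates as K(ω, λ) = g⊥(ω⊥) + ḡ(ω̄), where g⊥(ω⊥) = −(ω⊥)'R⊥ + (1/2)(ω⊥)'Σω⊥ and ḡ(ω̄) = −k Σ_{l=1}^m ω̄_l R̄_l + (k/2) Σ_{l=1}^m κ_{1l} ω̄_l² − Σ_{l=1}^m λ_l ∫_{[0,1]} log(1 + k ω̄_l j_l z) ν_l(dz) (equality in (−∞,+∞]). -/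
open MeasureTheory Set Matrix
open scoped ENNReal

/-- The vector `1_l ∈ ℝⁿ` (with `n = mk`, coordinates indexed by `Fin m × Fin k`) with ones
in the `k` coordinates of the `l`-th block and zeros elsewhere. -/
def oneVec (m k : ℕ) (l : Fin m) : Fin m × Fin k → ℝ :=
  fun p => if p.1 = l then 1 else 0

/-- The matrix `M_l`: block-diagonal with the `k×k` identity in the `l`-th diagonal block
and zeros elsewhere. -/
def blockId (m k : ℕ) (l : Fin m) : Matrix (Fin m × Fin k) (Fin m × Fin k) ℝ :=
  Matrix.of fun p q => if p = q ∧ p.1 = l then 1 else 0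

/-- The block-diagonal covariance matrix `Σ`, whose `l`-th diagonal `k×k` block is
`υ_l²((1−ρ_l) I_k + ρ_l 𝟙𝟙')` and whose off-diagonal blocks vanish. -/
noncomputable def blockSigma (m k : ℕ) (υ ρ : Fin m → ℝ) :
    Matrix (Fin m × Fin k) (Fin m × Fin k) ℝ :=
  Matrix.of fun p q =>
    if p.1 = q.1 then υ p.1 ^ 2 * (if p.2 = q.2 then 1 else ρ p.1) else 0

/-- `κ_{1l} = υ_l²(1 + (k−1)ρ_l)`. -/
noncomputable def kappa1 (m k : ℕ) (υ ρ : Fin m → ℝ) (l : Fin m) : ℝ :=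
  υ l ^ 2 * (1 + ((k : ℝ) - 1) * ρ l)

/-- `κ_{2l} = υ_l²(1 − ρ_l)`. -/
noncomputable def kappa2 (m k : ℕ) (υ ρ : Fin m → ℝ) (l : Fin m) : ℝ :=
  υ l ^ 2 * (1 - ρ l)

/-- `V⊥`, the orthogonal complement of the span of `1_1, …, 1_m`. -/
def Vperp (m k : ℕ) : Set (Fin m × Fin k → ℝ) :=
  {v | ∀ l, v ⬝ᵥ oneVec m k l = 0}

/-- The jump matrix whose `l`-th column is `j_l 1_l`. -/
def Jmat (m k : ℕ) (j : Fin m → ℝ) : Matrix (Fin m × Fin k) (Fin m) ℝ :=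
  Matrix.of fun p l => if p.1 = l then j l else 0

theorem aux_perp {m k : ℕ} {v : Fin m × Fin k → ℝ} (hv : v ∈ Vperp m k) (l : Fin m) :
    ∑ i, v (l, i) = 0 := by
  have h := hv l
  simp only [dotProduct, oneVec, Fintype.sum_prod_type, mul_ite, mul_one, mul_zero] at h
  rw [← h, Finset.sum_eq_single l]
  · simp
  · intro b _ hb
    simp [hb]
  · simp

theorem aux_apply {m k : ℕ} (a : Fin m → ℝ) (v : Fin m × Fin k → ℝ) (l : Fin m) (i : Fin k) :
    (∑ l, a l • oneVec m k l + v) (l, i) = a l + v (l, i) := by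
  simp [oneVec, Finset.sum_apply]

theorem aux_quad {m k : ℕ} (υ ρ : Fin m → ℝ) (w : Fin m × Fin k → ℝ) :
    w ⬝ᵥ (blockSigma m k υ ρ).mulVec w =
      ∑ l, υ l ^ 2 * ((1 - ρ l) * ∑ i, w (l, i) ^ 2 + ρ l * (∑ i, w (l, i)) ^ 2) := by
  have h1 : ∀ l i, (blockSigma m k υ ρ).mulVec w (l, i) =
      υ l ^ 2 * ((1 - ρ l) * w (l, i) + ρ l * ∑ i', w (l, i')) := by
    intro l i
    simp only [mulVec, dotProduct, blockSigma, Fintype.sum_prod_type, Matrix.of_apply]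
    rw [Finset.sum_eq_single l]
    · have h2 : ∀ x, (if l = l then υ l ^ 2 * (if i = x then 1 else ρ l) else 0) * w (l, x)
          = (if i = x then υ l ^ 2 * (1 - ρ l) * w (l, x) else 0)
            + υ l ^ 2 * ρ l * w (l, x) := by
        intro x
        by_cases hx : i = x
        · simp [hx]; ring
        · simp [hx]
      rw [Finset.sum_congr rfl (fun x _ => h2 x), Finset.sum_add_distrib, ← Finset.mul_sum]
      simp
      ring
    · intro b _ hb
      simp [Ne.symm hb]
    · simp
  simp only [dotProduct, Fintype.sum_prod_type, h1]
  refine Finset.sum_congr rfl fun l _ => ?_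
  have h3 : ∀ i, w (l, i) * (υ l ^ 2 * ((1 - ρ l) * w (l, i) + ρ l * ∑ i', w (l, i')))
      = υ l ^ 2 * (1 - ρ l) * w (l, i) ^ 2 + υ l ^ 2 * ρ l * (∑ i', w (l, i')) * w (l, i) := by
    intro i; ring
  rw [Finset.sum_congr rfl (fun x _ => h3 x), Finset.sum_add_distrib, ← Finset.mul_sum,
    ← Finset.mul_sum]
  ring

/-- Separation of the log-investor objective under the block structure: for
`ω = Σ_l ω̄_l 1_l + ω⊥ ∈ D` with `ω⊥ ∈ V⊥`, one has `K(ω, λ) = g⊥(ω⊥) + ḡ(ω̄)`. -/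
theorem logObjective_block_separation
    (m k : ℕ) (hm : 1 ≤ m) (hk : 2 ≤ k)
    (υ ρ : Fin m → ℝ) (hυ : ∀ l, 0 < υ l)
    (hρ : ∀ l, -(1 / ((k : ℝ) - 1)) < ρ l ∧ ρ l < 1)
    (j : Fin m → ℝ) (hj : ∀ l, j l ∈ Set.Icc (-1 : ℝ) 0)
    (Rbar : Fin m → ℝ) (Rperp : Fin m × Fin k → ℝ) (hRperp : Rperp ∈ Vperp m k)
    (ν : Fin m → Measure ℝ) (hν : ∀ l, IsProbabilityMeasure (ν l))
    (hνsupp : ∀ l, ν l (Set.Icc (0 : ℝ) 1)ᶜ = 0)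
    (lam : Fin m → ℝ) (hlam : ∀ l, 0 ≤ lam l)
    (ωbar : Fin m → ℝ) (ωperp : Fin m × Fin k → ℝ) (hωperp : ωperp ∈ Vperp m k)
    (hD : (∑ l, ωbar l • oneVec m k l + ωperp) ∈ Dset (Jmat m k j)) :
    Kobj (blockSigma m k υ ρ) (∑ l, Rbar l • oneVec m k l + Rperp) (Jmat m k j) ν
        (∑ l, ωbar l • oneVec m k l + ωperp) lam =
      (((-(ωperp ⬝ᵥ Rperp)
            + 2⁻¹ * (ωperp ⬝ᵥ (blockSigma m k υ ρ).mulVec ωperp)) : ℝ) : EReal)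
        + ((((-(k : ℝ)) * ∑ l, ωbar l * Rbar l
              + (k : ℝ) / 2 * ∑ l, kappa1 m k υ ρ l * ωbar l ^ 2) : ℝ) : EReal)
        - ∑ l, ((lam l : ℝ) : EReal) * Ilog (ν l) ((k : ℝ) * ωbar l * j l) := by
  have hJ : ∀ l, Matrix.vecMul (∑ l, ωbar l • oneVec m k l + ωperp) (Jmat m k j) l
      = (k : ℝ) * ωbar l * j l := by
    intro l
    simp only [vecMul, dotProduct, Fintype.sum_prod_type, aux_apply, Jmat, Matrix.of_apply]
    rw [Finset.sum_eq_single l]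
    · simp only [if_true]
      rw [← Finset.sum_mul, Finset.sum_add_distrib, aux_perp hωperp]
      simp
    · intro b _ hb
      simp [hb]
    · simp
  have hR : (∑ l, ωbar l • oneVec m k l + ωperp) ⬝ᵥ (∑ l, Rbar l • oneVec m k l + Rperp)
      = ωperp ⬝ᵥ Rperp + k * ∑ l, ωbar l * Rbar l := by
    simp only [dotProduct, Fintype.sum_prod_type, aux_apply]
    rw [Finset.mul_sum, ← Finset.sum_add_distrib]
    refine Finset.sum_congr rfl fun l _ => ?_
    simp only [add_mul, mul_add, Finset.sum_add_distrib, ← Finset.mul_sum, ← Finset.sum_mul,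
      aux_perp hωperp, aux_perp hRperp]
    simp
    ring
  have hQ : (∑ l, ωbar l • oneVec m k l + ωperp) ⬝ᵥ
        (blockSigma m k υ ρ).mulVec (∑ l, ωbar l • oneVec m k l + ωperp)
      = ωperp ⬝ᵥ (blockSigma m k υ ρ).mulVec ωperp
        + k * ∑ l, kappa1 m k υ ρ l * ωbar l ^ 2 := by
    rw [aux_quad, aux_quad, Finset.mul_sum, ← Finset.sum_add_distrib]
    refine Finset.sum_congr rfl fun l _ => ?_
    simp only [aux_apply, add_sq, Finset.sum_add_distrib, ← Finset.mul_sum,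
      aux_perp hωperp, kappa1]
    simp
    ring
  unfold Kobj
  simp only [hJ]
  rw [hR, hQ, ← EReal.coe_add]
  congr 2
  ring
end
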